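/- arXiv:math/0508039 — 3 statements merged into one kernel-verified Lean document; each statement's English description precedes it below -/
import Mathlib

section
/- Let d ≥ 1, σ = (σ_1,…,σ_d) ∈ ℝ^d with σ_i > −1 for all i, and β, γ ∈ ℝ with β > −1. For ν ∈ ℕ_0^d define the polynomial R_ν(x; σ, β, γ) = Π_{j=1}^d (a_j+1)_{ν_j} R_{ν_j}(x_j; σ_j, a_j, b_j), where a_j = β + |ν^{j+1}| + |X_{j−1}| and b_j = γ − |ν^{j+1}| − |σ^{j+1}| − (d−j) + |X_{j−1}|. Let W(x) = Π_{i=1}^d [(σ_i+1)_{x_i}/x_i!] · (β+1)_{|x|}/(γ+1)_{|x|} for x ∈ ℕ_0^d. Then for all ν, μ ∈ ℕ_0^d with 2|ν| < γ − |σ| − β − d − 1 and 2|μ| < γ − |σ| − β − d − 1, the family x ↦ R_ν(x;σ,β,γ) R_μ(x;σ,β,γ) W(x) is summable over ℕ_0^d and Σ_{x ∈ ℕ_0^d} R_ν(x) R_μ(x) W(x) = A_ν δ_{ν,μ}, where, setting δ_j = γ − β − 2|ν^{j+1}| − |σ^{j+1}| − (d−j) for 0 ≤ j ≤ d, A_ν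 = [(1+β)_{|ν|} Γ(1+γ) Γ(γ−β−|σ|−2|ν|−d)] / [Γ(γ−|σ|−|ν|+1−d) Γ(γ−β)] · Π_{j=1}^d [ν_j! (δ_j − ν_j)_{ν_j} (δ_{j−1}+1)_{ν_j} / (1+σ_j)_{ν_j}]. -/
open Finset

/-- Pochhammer symbol `(a)_k = a(a+1)⋯(a+k−1)`. -/
noncomputable def poch (a : ℝ) (k : ℕ) : ℝ := ∏ i ∈ Finset.range k, (a + i)

/-- The one-variable polynomials `R_n(x; α₁, α₂, α₃)` of (4.10). -/
noncomputable def Rpol (α₁ α₂ α₃ : ℝ) (n : ℕ) (x : ℝ) : ℝ :=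
  ∑ k ∈ Finset.range (n + 1),
    poch (-(n : ℝ)) k * poch ((n : ℝ) - α₃ + α₁ + α₂ + 1) k
      / (poch (α₁ + 1) k * poch (α₂ + 1) k) * poch (-x) k / (Nat.factorial k : ℝ)

/-- Tail sum `y_{t+1} + ⋯ + y_d` (paper notation `|y^{t+1}|`, 1-based),
i.e. the sum of `y i` over 0-based indices `i ≥ t`. -/
noncomputable def tailFrom (d : ℕ) (y : Fin d → ℝ) (t : ℕ) : ℝ :=
  ∑ i, if t ≤ i.val then y i else 0

/-- Head sum `y_1 + ⋯ + y_{j}` over 0-based indices `i < j`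
(paper notation `|Y_{j}|`). -/
noncomputable def headTo (d : ℕ) (y : Fin d → ℝ) (j : Fin d) : ℝ :=
  ∑ i, if i.val < j.val then y i else 0

/-- The parameter `α_{2,j} = β + |ν^{j+1}| + |X_{j−1}|` (0-based `j`). -/
noncomputable def aPar (d : ℕ) (β : ℝ) (ν x : Fin d → ℕ) (j : Fin d) : ℝ :=
  β + tailFrom d (fun i => (ν i : ℝ)) ((j : ℕ) + 1)
    + headTo d (fun i => (x i : ℝ)) j

/-- The parameter `α_{3,j} = γ − |ν^{j+1}| − |σ^{j+1}| − (d−j) + |X_{j−1}|`. -/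
noncomputable def bPar (d : ℕ) (γ : ℝ) (σ : Fin d → ℝ) (ν x : Fin d → ℕ)
    (j : Fin d) : ℝ :=
  γ - tailFrom d (fun i => (ν i : ℝ)) ((j : ℕ) + 1) - tailFrom d σ ((j : ℕ) + 1)
    - ((d : ℝ) - (j : ℕ) - 1) + headTo d (fun i => (x i : ℝ)) j

/-- The multivariable polynomials
`R_ν(x; σ, β, γ) = Π_j (α_{2,j}+1)_{ν_j} R_{ν_j}(x_j; σ_j, α_{2,j}, α_{3,j})`. -/
noncomputable def Rnu (d : ℕ) (σ : Fin d → ℝ) (β γ : ℝ) (ν x : Fin d → ℕ) : ℝ :=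
  ∏ j, poch (aPar d β ν x j + 1) (ν j)
    * Rpol (σ j) (aPar d β ν x j) (bPar d γ σ ν x j) (ν j) (x j)

/-- The weight `W(x) = Π_i (σ_i+1)_{x_i}/x_i! · (β+1)_{|x|}/(γ+1)_{|x|}`. -/
noncomputable def Wnu (d : ℕ) (σ : Fin d → ℝ) (β γ : ℝ) (x : Fin d → ℕ) : ℝ :=
  (∏ i, poch (σ i + 1) (x i) / (Nat.factorial (x i) : ℝ))
    * poch (β + 1) (∑ i, x i) / poch (γ + 1) (∑ i, x i)

/-- `δ_t = γ − β − 2|ν^{t+1}| − |σ^{t+1}| − (d−t)` for `0 ≤ t ≤ d`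
(paper 1-based index `t`). -/
noncomputable def delPar (d : ℕ) (β γ : ℝ) (σ : Fin d → ℝ) (ν : Fin d → ℕ)
    (t : ℕ) : ℝ :=
  γ - β - 2 * tailFrom d (fun i => (ν i : ℝ)) t - tailFrom d σ t - ((d : ℝ) - t)

/-- The norm `A_ν` of (5.19). -/
noncomputable def Anu (d : ℕ) (σ : Fin d → ℝ) (β γ : ℝ) (ν : Fin d → ℕ) : ℝ :=
  poch (1 + β) (∑ i, ν i) * Real.Gamma (1 + γ)
      * Real.Gamma (γ - β - (∑ i, σ i) - 2 * (∑ i, (ν i : ℝ)) - d)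
      / (Real.Gamma (γ - (∑ i, σ i) - (∑ i, (ν i : ℝ)) + 1 - d)
          * Real.Gamma (γ - β))
    * ∏ j, (Nat.factorial (ν j) : ℝ)
        * poch (delPar d β γ σ ν ((j : ℕ) + 1) - ν j) (ν j)
        * poch (delPar d β γ σ ν (j : ℕ) + 1) (ν j) / poch (1 + σ j) (ν j)

theorem poch_zero (a : ℝ) : poch a 0 = 1 := by simp [poch]

theorem poch_succ (a : ℝ) (n : ℕ) : poch a (n + 1) = poch a n * (a + n) := by
  simp [poch, Finset.prod_range_succ]

theorem poch_add (a : ℝ) (m n : ℕ) : poch a (m + n) = poch a m * poch (a + m) n := by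
  simp [poch, Finset.prod_range_add, add_assoc]

theorem poch_pos {a : ℝ} (ha : 0 < a) (n : ℕ) : 0 < poch a n :=
  Finset.prod_pos fun _ _ => by positivity

theorem poch_eq_eval (a : ℝ) (n : ℕ) : poch a n = (ascPochhammer ℝ n).eval a := by
  induction n with
  | zero => simp [poch_zero]
  | succ n ih => rw [poch_succ, ih, ascPochhammer_succ_eval]

theorem Gamma_add_nat_eq {a : ℝ} (ha : 0 < a) (n : ℕ) :
    Real.Gamma (a + n) = Real.Gamma a * poch a n := by
  induction n with
  | zero => simp [poch_zero]
  | succ n ih =>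
    rw [poch_succ, ← mul_assoc, ← ih, Nat.cast_succ, ← add_assoc,
      Real.Gamma_add_one (by positivity)]
    ring

theorem poch_neg (a : ℝ) (n : ℕ) : poch (-a) n = (-1) ^ n * poch (a - n + 1) n := by
  have h1 : ((-1 : ℝ)) ^ n = ∏ _i ∈ Finset.range n, (-1 : ℝ) := by simp
  unfold poch
  rw [← Finset.prod_range_reflect, h1, ← Finset.prod_mul_distrib]
  refine Finset.prod_congr rfl fun i hi => ?_
  have h : i + 1 ≤ n := Finset.mem_range.1 hi
  rw [Nat.sub_sub, Nat.cast_sub (by omega)]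
  push_cast
  ring

theorem poch_neg_natCast (n k : ℕ) :
    poch (-(n : ℝ)) k = (-1) ^ k * (n.choose k * k.factorial : ℕ) := by
  rw [poch_eq_eval, ascPochhammer_eval_neg_eq_descPochhammer, descPochhammer_eval_eq_descFactorial,
    Nat.descFactorial_eq_factorial_mul_choose, mul_comm (Nat.choose n k)]

theorem hasSum_one_sub_rpow (a : ℝ) {t : ℝ} (h0 : 0 < t) (h1 : t < 1) :
    HasSum (fun x : ℕ => poch a x / (x.factorial : ℝ) * t ^ x) ((1 - t) ^ (-a)) := by
  have h := (Real.one_div_one_sub_rpow_hasFPowerSeriesOnBall_zero a).hasSum (y := t) (by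
    simp [enorm_eq_nnnorm, ← NNReal.coe_lt_coe, abs_of_pos h0, h1])
  rw [zero_add, one_div, ← Real.rpow_neg (by linarith)] at h
  refine HasSum.congr_fun h fun x => ?_
  rw [FormalMultilinearSeries.ofScalars_apply_eq, smul_eq_mul, ← Ring.multichoose_eq, poch_eq_eval,
    ← Polynomial.ascPochhammer_smeval_eq_eval, ← Ring.factorial_nsmul_multichoose_eq_ascPochhammer,
    nsmul_eq_mul, mul_div_cancel_left₀ _ (by positivity)]

open MeasureTheory Set in
theorem lintegral_beta {p q : ℝ} (hp : 0 < p) (hq : 0 < q) :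
    ∫⁻ t in Ioo (0 : ℝ) 1, ENNReal.ofReal (t ^ (p - 1) * (1 - t) ^ (q - 1))
      = ENNReal.ofReal (ProbabilityTheory.beta p q) := by
  have hB := ProbabilityTheory.beta_pos hp hq
  have h := ProbabilityTheory.lintegral_betaPDF_eq_one hp hq
  rw [ProbabilityTheory.lintegral_betaPDF] at h
  calc _ = ∫⁻ t in Ioo (0 : ℝ) 1, ENNReal.ofReal (ProbabilityTheory.beta p q) *
        ENNReal.ofReal (1 / ProbabilityTheory.beta p q * t ^ (p - 1) * (1 - t) ^ (q - 1)) := by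
        refine lintegral_congr fun t => ?_
        rw [← ENNReal.ofReal_mul hB.le]
        congr 1
        field_simp
    _ = _ := by
        rw [lintegral_const_mul _ (by fun_prop), h, mul_one]

open MeasureTheory Set in
/-- Gauss's summation theorem for positive parameters. -/
theorem hasSum_gauss {a b c : ℝ} (ha : 0 < a) (hb : 0 < b) (hc : a + b < c) :
    HasSum (fun x : ℕ => poch a x * poch b x / (x.factorial * poch c x))
      (Real.Gamma c * Real.Gamma (c - a - b) / (Real.Gamma (c - a) * Real.Gamma (c - b))) := by
  have hcb : 0 < c - b := by linarith
  have hs : 0 < c - a - b := by linarith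
  have hbeta (x : ℕ) : ProbabilityTheory.beta (b + x) (c - b)
      = ProbabilityTheory.beta b (c - b) * (poch b x / poch c x) := by
    have hc0 : 0 < c := by linarith
    unfold ProbabilityTheory.beta
    rw [show b + x + (c - b) = c + x by ring, show b + (c - b) = c by ring,
      Gamma_add_nat_eq hb, Gamma_add_nat_eq hc0]
    ring
  have hsum : ∑' x : ℕ, ENNReal.ofReal
        (poch a x / (x.factorial : ℝ) * ProbabilityTheory.beta (b + x) (c - b))
      = ENNReal.ofReal (ProbabilityTheory.beta b (c - a - b)) := by
    rw [← lintegral_beta hb hs]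
    have hx (x : ℕ) : ENNReal.ofReal
        (poch a x / (x.factorial : ℝ) * ProbabilityTheory.beta (b + x) (c - b))
        = ∫⁻ t in Ioo (0 : ℝ) 1, ENNReal.ofReal (poch a x / (x.factorial : ℝ)) *
          ENNReal.ofReal (t ^ (b + x - 1) * (1 - t) ^ (c - b - 1)) := by
      have := poch_pos ha x
      rw [lintegral_const_mul _ (by fun_prop), lintegral_beta (by positivity) hcb,
        ENNReal.ofReal_mul (by positivity)]
    simp_rw [hx]
    rw [← lintegral_tsum (fun x => by fun_prop)]
    refine setLIntegral_congr_fun measurableSet_Ioo fun t ht => ?_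
    obtain ⟨h0, h1⟩ := ht
    have h1' : 0 < 1 - t := by linarith
    have h := (hasSum_one_sub_rpow a h0 h1).mul_right (t ^ (b - 1) * (1 - t) ^ (c - b - 1))
    have hval : (1 - t) ^ (-a) * (t ^ (b - 1) * (1 - t) ^ (c - b - 1))
        = t ^ (b - 1) * (1 - t) ^ (c - a - b - 1) := by
      rw [mul_left_comm, ← Real.rpow_add h1']
      congr 2
      ring
    rw [hval] at h
    rw [← h.tsum_eq, ENNReal.ofReal_tsum_of_nonneg (fun x => ?_) h.summable]
    · refine tsum_congr fun x => ?_
      have := poch_pos ha x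
      rw [← ENNReal.ofReal_mul (by positivity), show b + x - 1 = (b - 1) + x by ring,
        Real.rpow_add h0, Real.rpow_natCast]
      congr 1
      ring
    · have := poch_pos ha x
      positivity
  have hnn (x : ℕ) :
      0 ≤ poch a x / (x.factorial : ℝ) * ProbabilityTheory.beta (b + x) (c - b) := by
    have := poch_pos ha x
    have := ProbabilityTheory.beta_pos (α := b + x) (by positivity) hcb
    positivity
  have h := ENNReal.hasSum_toReal (hsum.trans_ne ENNReal.ofReal_ne_top)
  rw [← ENNReal.tsum_toReal_eq (fun _ => ENNReal.ofReal_ne_top), hsum,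
    ENNReal.toReal_ofReal (ProbabilityTheory.beta_pos hb hs).le] at h
  simp_rw [ENNReal.toReal_ofReal (hnn _), hbeta] at h
  have hB := ProbabilityTheory.beta_pos hb hcb
  have hval : Real.Gamma c * Real.Gamma (c - a - b) / (Real.Gamma (c - a) * Real.Gamma (c - b))
      = ProbabilityTheory.beta b (c - a - b) / ProbabilityTheory.beta b (c - b) := by
    unfold ProbabilityTheory.beta
    rw [show b + (c - b) = c by ring, show b + (c - a - b) = c - a by ring]
    field_simp
  rw [hval]
  refine (h.div_const (ProbabilityTheory.beta b (c - b))).congr_fun fun x => ?_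
  field_simp

/-- The one-variable weight `(σ+1)_x (β+1)_x / (x! (γ+1)_x)`. -/
noncomputable def hahnWeight (σ β γ : ℝ) (x : ℕ) : ℝ :=
  poch (σ + 1) x / (x.factorial : ℝ) * (poch (β + 1) x / poch (γ + 1) x)

theorem hasSum_hahnWeight_moment {σ β γ : ℝ} (hσ : -1 < σ) (hβ : -1 < β) (k l : ℕ)
    (h : (k + l : ℝ) < γ - σ - β - 1) :
    HasSum (fun x : ℕ => hahnWeight σ β γ x * (poch (-(x : ℝ)) k * poch (x + σ + 1) l))
      ((-1) ^ k * (poch (σ + 1) (k + l) * poch (β + 1) k * Real.Gamma (γ + 1)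
        * Real.Gamma (γ - σ - β - 1 - l - k)
        / (Real.Gamma (γ - σ - l) * Real.Gamma (γ - β)))) := by
  have hγ : 0 < γ + 1 := by linarith
  have hg := (hasSum_gauss (a := σ + 1 + (k + l : ℕ)) (b := β + 1 + k) (c := γ + 1 + k)
    (by push_cast; linarith) (by linarith) (by push_cast; linarith)).mul_left
      ((-1) ^ k * (poch (σ + 1) (k + l) * (poch (β + 1) k / poch (γ + 1) k)))
  rw [← hasSum_nat_add_iff' k, Finset.sum_eq_zero, sub_zero]
  · have hγk := (poch_pos hγ k).ne'
    rw [Gamma_add_nat_eq hγ, show γ + 1 + k - (σ + 1 + (k + l : ℕ)) - (β + 1 + k)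
        = γ - σ - β - 1 - l - k by push_cast; ring,
      show γ + 1 + k - (σ + 1 + (k + l : ℕ)) = γ - σ - l by push_cast; ring,
      show γ + 1 + k - (β + 1 + k) = γ - β by ring] at hg
    have hval : (-1) ^ k * (poch (σ + 1) (k + l) * (poch (β + 1) k / poch (γ + 1) k)) *
        (Real.Gamma (γ + 1) * poch (γ + 1) k * Real.Gamma (γ - σ - β - 1 - l - k)
          / (Real.Gamma (γ - σ - l) * Real.Gamma (γ - β)))
        = (-1) ^ k * (poch (σ + 1) (k + l) * poch (β + 1) k * Real.Gamma (γ + 1)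
          * Real.Gamma (γ - σ - β - 1 - l - k)
          / (Real.Gamma (γ - σ - l) * Real.Gamma (γ - β))) := by
      field_simp
    rw [hval] at hg
    refine hg.congr_fun fun x => ?_
    have h1 : poch (σ + 1) (x + k) * poch ((x + k : ℕ) + σ + 1) l
        = poch (σ + 1) (k + l) * poch (σ + 1 + (k + l : ℕ)) x := by
      rw [← poch_add, show k + l + x = x + k + l by ring, poch_add _ (x + k)]
      congr 2
      ring
    have h2 : ((x + k).choose k : ℝ) * k.factorial * x.factorial = (x + k).factorial := by
      rw [mul_right_comm]
      exact_mod_cast Nat.add_choose_mul_factorial_mul_factorial x k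
    have hγx : poch (γ + 1 + k) x ≠ 0 := (poch_pos (by linarith) x).ne'
    rw [poch_neg_natCast, hahnWeight, add_comm x k, poch_add (β + 1), poch_add (γ + 1),
      add_comm k x]
    push_cast at h1 ⊢
    field_simp
    rw [← h2]
    linear_combination (poch (β + 1) k * poch (β + 1 + k) x * ((x + k).choose k : ℝ)
      * k.factorial * x.factorial) * h1
  · intro i hi
    rw [poch_neg_natCast, Nat.choose_eq_zero_of_lt (Finset.mem_range.1 hi)]
    simp

theorem sum_neg_one_pow_choose_eq_fwdDiff (f : ℝ → ℝ) (n : ℕ) (y : ℝ) :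
    ∑ k ∈ Finset.range (n + 1), (-1) ^ k * (n.choose k : ℝ) * f (y + k)
      = (-1) ^ n * (fwdDiff 1)^[n] f y := by
  rw [fwdDiff_iter_eq_sum_shift, Finset.mul_sum]
  refine Finset.sum_congr rfl fun k hk => ?_
  have hk : k ≤ n := Nat.lt_succ_iff.1 (Finset.mem_range.1 hk)
  have h : (-1 : ℝ) ^ n * (-1) ^ (n - k) = (-1) ^ k := by
    rw [← pow_add, show n + (n - k) = k + 2 * (n - k) by omega, pow_add, pow_mul]
    simp
  simp only [zsmul_eq_mul, nsmul_eq_mul, mul_one]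
  push_cast
  rw [← h]
  ring

theorem sum_neg_one_pow_choose_mul_eval {P : Polynomial ℝ} {n : ℕ} (hP : P.natDegree < n) :
    ∑ k ∈ Finset.range (n + 1), (-1) ^ k * (n.choose k : ℝ) * P.eval (k : ℝ) = 0 := by
  have h := sum_neg_one_pow_choose_eq_fwdDiff P.eval n 0
  rw [P.fwdDiff_iter_eq_zero_of_degree_lt hP] at h
  simpa using h

theorem fwdDiff_iter_one_div_sub (u : ℝ) (n : ℕ) (y : ℝ) (h : y + n < u) :
    (fwdDiff 1)^[n] (fun x : ℝ => 1 / (u - x)) y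
      = (n.factorial : ℝ) / poch (u - y - n) (n + 1) := by
  induction n generalizing y with
  | zero => simp [poch]
  | succ n ih =>
    push_cast at h
    rw [Function.iterate_succ_apply', fwdDiff, ih _ (by linarith), ih _ (by linarith),
      show u - (y + 1) - n = u - y - (n + 1 : ℕ) by push_cast; ring]
    have h1 : poch (u - y - (n + 1 : ℕ)) (n + 1 + 1)
        = poch (u - y - (n + 1 : ℕ)) (n + 1) * (u - y) := by
      rw [poch_succ]
      push_cast
      ring
    have h2 : poch (u - y - (n + 1 : ℕ)) (n + 1 + 1)
        = (u - y - (n + 1 : ℕ)) * poch (u - y - n) (n + 1) := by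
      rw [add_comm (n + 1) 1, poch_add]
      congr 2
      · simp [poch]
      · push_cast
        ring
    have p1 : poch (u - y - (n + 1 : ℕ)) (n + 1) ≠ 0 :=
      (poch_pos (by push_cast; linarith) _).ne'
    have p2 : poch (u - y - n) (n + 1) ≠ 0 := (poch_pos (by linarith) _).ne'
    have p3 : poch (u - y - (n + 1 : ℕ)) (n + 1 + 1) ≠ 0 :=
      (poch_pos (by push_cast; linarith) _).ne'
    rw [div_sub_div _ _ p1 p2, div_eq_div_iff (mul_ne_zero p1 p2) p3, Nat.factorial_succ]
    push_cast at *
    linear_combination (n.factorial * poch (u - y - n) (n + 1)) * h1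
      - (n.factorial * poch (u - y - (n + 1)) (n + 1)) * h2

theorem sum_neg_one_pow_choose_mul_eval_div {P : Polynomial ℝ} {n : ℕ} (hP : P.natDegree ≤ n)
    {u : ℝ} (hu : n < u) :
    ∑ k ∈ Finset.range (n + 1), (-1) ^ k * (n.choose k : ℝ) * (P.eval (k : ℝ) / (u - k))
      = (-1) ^ n * n.factorial * P.eval u / poch (u - n) (n + 1) := by
  have h0 := sum_neg_one_pow_choose_eq_fwdDiff (fun x => 1 / (u - x)) n 0
  rw [fwdDiff_iter_one_div_sub _ _ _ (by linarith)] at h0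
  simp only [zero_add, sub_zero] at h0
  set q := P /ₘ (Polynomial.X - Polynomial.C u) with hq
  have hPq (x : ℝ) : P.eval x = P.eval u + (x - u) * q.eval x := by
    conv_lhs => rw [← Polynomial.modByMonic_add_div P (Polynomial.X - Polynomial.C u),
      Polynomial.modByMonic_X_sub_C_eq_C_eval]
    simp [hq]
  have hq0 : ∑ k ∈ Finset.range (n + 1), (-1) ^ k * (n.choose k : ℝ) * q.eval (k : ℝ) = 0 := by
    by_cases hd : P.natDegree = 0
    · have : q = 0 := by
        rw [hq, Polynomial.divByMonic_eq_zero_iff (Polynomial.monic_X_sub_C u),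
          Polynomial.degree_X_sub_C]
        exact Polynomial.degree_le_natDegree.trans_lt (by simp [hd])
      simp [this]
    · refine sum_neg_one_pow_choose_mul_eval ?_
      rw [hq, Polynomial.natDegree_divByMonic _ (Polynomial.monic_X_sub_C u),
        Polynomial.natDegree_X_sub_C]
      omega
  have hterm : ∀ k ∈ Finset.range (n + 1),
      (-1) ^ k * (n.choose k : ℝ) * (P.eval (k : ℝ) / (u - k))
        = P.eval u * ((-1) ^ k * (n.choose k : ℝ) * (1 / (u - k)))
          - (-1) ^ k * (n.choose k : ℝ) * q.eval (k : ℝ) := by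
    intro k hk
    have hk : (k : ℝ) ≤ n := by exact_mod_cast Nat.lt_succ_iff.1 (Finset.mem_range.1 hk)
    have : u - k ≠ 0 := by linarith
    rw [hPq]
    field_simp
    ring
  rw [Finset.sum_congr rfl hterm, Finset.sum_sub_distrib, ← Finset.mul_sum, h0, hq0]
  ring

theorem eval_ascPochhammer_comp (q : Polynomial ℝ) (n : ℕ) (x : ℝ) :
    ((ascPochhammer ℝ n).comp q).eval x = poch (q.eval x) n := by
  rw [Polynomial.eval_comp, poch_eq_eval]

/-- The coefficient of `(-x)_k` in `Rpol σ β γ n x`. -/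
noncomputable def RpolCoeff (σ β γ : ℝ) (n k : ℕ) : ℝ :=
  poch (-(n : ℝ)) k * poch ((n : ℝ) - γ + σ + β + 1) k
    / (poch (σ + 1) k * poch (β + 1) k) / (k.factorial : ℝ)

theorem Rpol_eq_sum (σ β γ : ℝ) (n : ℕ) (x : ℝ) :
    Rpol σ β γ n x = ∑ k ∈ Finset.range (n + 1), RpolCoeff σ β γ n k * poch (-x) k :=
  Finset.sum_congr rfl fun k _ => by rw [RpolCoeff]; ring

/-- The value of `∑ x, w(x) R_n(x) x^n`. -/
noncomputable def RpolTopMoment (σ β γ : ℝ) (n : ℕ) : ℝ :=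
  Real.Gamma (γ + 1) * Real.Gamma (γ - σ - β - 1 - 2 * n) * ((-1) ^ n * n.factorial
    * poch (γ - β - n) n) / (Real.Gamma (γ - σ - n) * Real.Gamma (γ - β))

theorem RpolCoeff_mul_moment {σ β γ : ℝ} (hσ : -1 < σ) (hβ : -1 < β) {n k l : ℕ} (hk : k ≤ n)
    (h : (2 * n : ℝ) < γ - σ - β - 1) :
    RpolCoeff σ β γ n k * ((-1) ^ k * (poch (σ + 1) (k + l) * poch (β + 1) k
        * Real.Gamma (γ + 1) * Real.Gamma (γ - σ - β - 1 - l - k)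
        / (Real.Gamma (γ - σ - l) * Real.Gamma (γ - β))))
      = Real.Gamma (γ + 1) * Real.Gamma (γ - σ - β - 1 - n + 1)
          / (Real.Gamma (γ - σ - l) * Real.Gamma (γ - β))
        * ((-1) ^ k * (n.choose k : ℝ) * (poch (σ + 1 + k) l
          * (Real.Gamma (γ - σ - β - 1 - l - k) / Real.Gamma (γ - σ - β - 1 - n - k + 1)))) := by
  have hkn : (k : ℝ) ≤ n := by exact_mod_cast hk
  have hpos : 0 < γ - σ - β - 1 - n - k + 1 := by linarith
  have h1 := Gamma_add_nat_eq hpos k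
  rw [show γ - σ - β - 1 - n - k + 1 + k = γ - σ - β - 1 - n + 1 by ring] at h1
  have h2 : poch ((n : ℝ) - γ + σ + β + 1) k
      = (-1) ^ k * poch (γ - σ - β - 1 - n - k + 1) k := by
    rw [← poch_neg]
    congr 1
    ring
  have hσk : poch (σ + 1) k ≠ 0 := (poch_pos (by linarith) k).ne'
  have hβk : poch (β + 1) k ≠ 0 := (poch_pos (by linarith) k).ne'
  have hs : ((-1 : ℝ) ^ k) * (-1) ^ k = 1 := by rw [← mul_pow]; simp
  rw [RpolCoeff, poch_neg_natCast, h2, h1, poch_add (σ + 1) k l]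
  push_cast
  field_simp
  rw [sq, hs]
  ring

theorem hasSum_hahnWeight_mul_Rpol_mul_poch {σ β γ : ℝ} (hσ : -1 < σ) (hβ : -1 < β) {n l : ℕ}
    (hl : l ≤ n) (h : (2 * n : ℝ) < γ - σ - β - 1) :
    HasSum (fun x : ℕ => hahnWeight σ β γ x * (Rpol σ β γ n x * poch (x + σ + 1) l))
      (if l = n then RpolTopMoment σ β γ n else 0) := by
  have hln : (l : ℝ) ≤ n := by exact_mod_cast hl
  have hkn {k : ℕ} (hk : k ∈ Finset.range (n + 1)) : (k : ℝ) ≤ n := by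
    exact_mod_cast Nat.lt_succ_iff.1 (Finset.mem_range.1 hk)
  have hS := hasSum_sum (s := Finset.range (n + 1)) fun k hk =>
    (hasSum_hahnWeight_moment hσ hβ k l (γ := γ) (by linarith [hkn hk])).mul_left
      (RpolCoeff σ β γ n k)
  rw [Finset.sum_congr rfl fun k hk => RpolCoeff_mul_moment hσ hβ (l := l)
    (Nat.lt_succ_iff.1 (Finset.mem_range.1 hk)) h, ← Finset.mul_sum] at hS
  have hpoly (m : ℕ) (x : ℝ) : ((ascPochhammer ℝ m).comp (Polynomial.X + Polynomial.C (σ + 1))).eval x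
      = poch (σ + 1 + x) m := by
    rw [eval_ascPochhammer_comp]
    simp [add_comm]
  have hdeg (m : ℕ) :
      ((ascPochhammer ℝ m).comp (Polynomial.X + Polynomial.C (σ + 1))).natDegree = m := by
    rw [Polynomial.natDegree_comp, ascPochhammer_natDegree, Polynomial.natDegree_X_add_C, mul_one]
  have hval : Real.Gamma (γ + 1) * Real.Gamma (γ - σ - β - 1 - n + 1)
          / (Real.Gamma (γ - σ - l) * Real.Gamma (γ - β))
        * ∑ k ∈ Finset.range (n + 1), ((-1) ^ k * (n.choose k : ℝ) * (poch (σ + 1 + k) l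
          * (Real.Gamma (γ - σ - β - 1 - l - k) / Real.Gamma (γ - σ - β - 1 - n - k + 1))))
        = if l = n then RpolTopMoment σ β γ n else 0 := by
    split_ifs with hc
    · subst hc
      have hterm : ∀ k ∈ Finset.range (l + 1), (-1) ^ k * (l.choose k : ℝ) * (poch (σ + 1 + k) l
          * (Real.Gamma (γ - σ - β - 1 - l - k) / Real.Gamma (γ - σ - β - 1 - l - k + 1)))
          = (-1) ^ k * (l.choose k : ℝ) * (((ascPochhammer ℝ l).comp
            (Polynomial.X + Polynomial.C (σ + 1))).eval (k : ℝ) / (γ - σ - β - 1 - l - k)) := by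
        intro k hk
        have hpos : 0 < γ - σ - β - 1 - l - k := by linarith [hkn hk]
        rw [hpoly, Real.Gamma_add_one hpos.ne']
        field_simp
      rw [Finset.sum_congr rfl hterm, sum_neg_one_pow_choose_mul_eval_div (hdeg l).le
        (by linarith), hpoly, RpolTopMoment,
        show σ + 1 + (γ - σ - β - 1 - l) = γ - β - l by ring,
        show γ - σ - β - 1 - l - l = γ - σ - β - 1 - 2 * l by ring]
      have hpos : 0 < γ - σ - β - 1 - 2 * l := by linarith
      have h1 := Gamma_add_nat_eq hpos (l + 1)
      rw [show γ - σ - β - 1 - 2 * l + (l + 1 : ℕ) = γ - σ - β - 1 - l + 1 by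
        push_cast; ring] at h1
      have hp := (poch_pos hpos (l + 1)).ne'
      rw [h1]
      field_simp
    · have hlt : l < n := lt_of_le_of_ne hl hc
      set P : Polynomial ℝ := (ascPochhammer ℝ l).comp (Polynomial.X + Polynomial.C (σ + 1))
        * (ascPochhammer ℝ (n - 1 - l)).comp
          (Polynomial.C (γ - σ - β - 1 - n + 1) - Polynomial.X) with hP
      have hterm : ∀ k ∈ Finset.range (n + 1), (-1) ^ k * (n.choose k : ℝ) * (poch (σ + 1 + k) l
          * (Real.Gamma (γ - σ - β - 1 - l - k) / Real.Gamma (γ - σ - β - 1 - n - k + 1)))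
          = (-1) ^ k * (n.choose k : ℝ) * P.eval (k : ℝ) := by
        intro k hk
        have hpos : 0 < γ - σ - β - 1 - n - k + 1 := by linarith [hkn hk]
        have h1 := Gamma_add_nat_eq hpos (n - 1 - l)
        rw [show γ - σ - β - 1 - n - k + 1 + (n - 1 - l : ℕ) = γ - σ - β - 1 - l - k by
          rw [Nat.sub_sub, Nat.cast_sub (by omega)]; push_cast; ring] at h1
        have := (Real.Gamma_pos_of_pos hpos).ne'
        rw [hP, Polynomial.eval_mul, hpoly, eval_ascPochhammer_comp, h1,
          mul_div_cancel_left₀ _ this]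
        congr 3
        simp
        ring
      rw [Finset.sum_congr rfl hterm, sum_neg_one_pow_choose_mul_eval, mul_zero]
      refine Polynomial.natDegree_mul_le.trans_lt ?_
      rw [hdeg, Polynomial.natDegree_comp, ascPochhammer_natDegree]
      have : (Polynomial.C (γ - σ - β - 1 - n + 1) - Polynomial.X).natDegree ≤ 1 :=
        (Polynomial.natDegree_sub_le _ _).trans
          (max_le (by rw [Polynomial.natDegree_C]; omega) Polynomial.natDegree_X_le)
      have := Nat.mul_le_mul_left (n - 1 - l) this
      omega
  rw [hval] at hS
  refine hS.congr_fun fun x => ?_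
  rw [Rpol_eq_sum, Finset.sum_mul, Finset.mul_sum]
  exact Finset.sum_congr rfl fun k _ => by ring

theorem hasSum_hahnWeight_mul_Rpol_mul_eval {σ β γ : ℝ} (hσ : -1 < σ) (hβ : -1 < β) {n : ℕ}
    (h : (2 * n : ℝ) < γ - σ - β - 1) {l : ℕ} (hl : l ≤ n) (P : Polynomial ℝ)
    (hP : P.natDegree ≤ l) :
    HasSum (fun x : ℕ => hahnWeight σ β γ x * (Rpol σ β γ n x * P.eval (x : ℝ)))
      (P.coeff n * RpolTopMoment σ β γ n) := by
  set A : ℕ → Polynomial ℝ := fun m =>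
    (ascPochhammer ℝ m).comp (Polynomial.X + Polynomial.C (σ + 1)) with hA
  have hAdeg (m : ℕ) : (A m).natDegree = m := by
    rw [hA, Polynomial.natDegree_comp, ascPochhammer_natDegree, Polynomial.natDegree_X_add_C,
      mul_one]
  have hAmonic (m : ℕ) : (A m).Monic := (monic_ascPochhammer ℝ m).comp_X_add_C _
  have hAcoeff (m : ℕ) (hm : m ≤ n) : (A m).coeff n = if m = n then 1 else 0 := by
    split_ifs with hc
    · have := (hAmonic m).coeff_natDegree
      rw [hAdeg] at this
      rw [← this, hc]
    · exact Polynomial.coeff_eq_zero_of_natDegree_lt (by rw [hAdeg]; omega)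
  have key (m : ℕ) (hm : m ≤ n) (c : ℝ) (P : Polynomial ℝ)
      (hQ : HasSum (fun x : ℕ =>
          hahnWeight σ β γ x * (Rpol σ β γ n x * (P - Polynomial.C c * A m).eval (x : ℝ)))
        ((P - Polynomial.C c * A m).coeff n * RpolTopMoment σ β γ n)) :
      HasSum (fun x : ℕ => hahnWeight σ β γ x * (Rpol σ β γ n x * P.eval (x : ℝ)))
        (P.coeff n * RpolTopMoment σ β γ n) := by
    have hadd := hQ.add ((hasSum_hahnWeight_mul_Rpol_mul_poch hσ hβ hm h).mul_left c)
    have hval : (P - Polynomial.C c * A m).coeff n * RpolTopMoment σ β γ n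
        + c * (if m = n then RpolTopMoment σ β γ n else 0)
        = P.coeff n * RpolTopMoment σ β γ n := by
      rw [Polynomial.coeff_sub, Polynomial.coeff_C_mul, hAcoeff m hm]
      split_ifs <;> ring
    rw [hval] at hadd
    refine hadd.congr_fun fun x => ?_
    rw [Polynomial.eval_sub, Polynomial.eval_mul, Polynomial.eval_C, hA, eval_ascPochhammer_comp,
      Polynomial.eval_add, Polynomial.eval_X, Polynomial.eval_C, ← add_assoc]
    ring
  induction l generalizing P with
  | zero =>
    refine key 0 hl (P.coeff 0) P ?_
    have : P - Polynomial.C (P.coeff 0) * A 0 = 0 := by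
      simp [hA, ← Polynomial.eq_C_of_natDegree_le_zero hP]
    rw [this]
    simp [hasSum_zero]
  | succ l ih =>
    refine key (l + 1) hl (P.coeff (l + 1)) P (ih (by omega) _ ?_)
    have h1 : (P - Polynomial.C (P.coeff (l + 1)) * A (l + 1)).natDegree ≤ l + 1 :=
      (Polynomial.natDegree_sub_le _ _).trans (max_le hP
        ((Polynomial.natDegree_C_mul_le _ _).trans (hAdeg _).le))
    have h2 := (hAmonic (l + 1)).coeff_natDegree
    rw [hAdeg] at h2
    refine Polynomial.natDegree_le_pred h1 ?_
    rw [Polynomial.coeff_sub, Polynomial.coeff_C_mul, h2]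
    ring

/-- `Rpol` as a polynomial in its last argument. -/
noncomputable def RpolPoly (σ β γ : ℝ) (n : ℕ) : Polynomial ℝ :=
  ∑ k ∈ Finset.range (n + 1),
    Polynomial.C (RpolCoeff σ β γ n k) * (ascPochhammer ℝ k).comp (-Polynomial.X)

theorem eval_RpolPoly (σ β γ : ℝ) (n : ℕ) (x : ℝ) :
    (RpolPoly σ β γ n).eval x = Rpol σ β γ n x := by
  rw [RpolPoly, Polynomial.eval_finsetSum, Rpol_eq_sum]
  refine Finset.sum_congr rfl fun k _ => ?_
  rw [Polynomial.eval_mul, Polynomial.eval_C, eval_ascPochhammer_comp]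
  simp

theorem natDegree_ascPochhammer_comp_neg_X (k : ℕ) :
    ((ascPochhammer ℝ k).comp (-Polynomial.X)).natDegree = k := by
  rw [Polynomial.natDegree_comp, ascPochhammer_natDegree, Polynomial.natDegree_neg,
    Polynomial.natDegree_X, mul_one]

theorem natDegree_RpolPoly_le (σ β γ : ℝ) (n : ℕ) : (RpolPoly σ β γ n).natDegree ≤ n := by
  refine Polynomial.natDegree_sum_le_of_forall_le _ _ fun k hk => ?_
  refine (Polynomial.natDegree_C_mul_le _ _).trans ?_
  rw [natDegree_ascPochhammer_comp_neg_X]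
  exact Nat.lt_succ_iff.1 (Finset.mem_range.1 hk)

theorem coeff_RpolPoly (σ β γ : ℝ) (n : ℕ) :
    (RpolPoly σ β γ n).coeff n
      = poch ((n : ℝ) - γ + σ + β + 1) n / (poch (σ + 1) n * poch (β + 1) n) := by
  have htop : ((ascPochhammer ℝ n).comp (-Polynomial.X)).coeff n = (-1) ^ n := by
    have h := Polynomial.leadingCoeff_comp (p := ascPochhammer ℝ n) (q := -Polynomial.X)
      (by simp)
    rw [(monic_ascPochhammer ℝ n).leadingCoeff, ascPochhammer_natDegree, Polynomial.leadingCoeff,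
      natDegree_ascPochhammer_comp_neg_X] at h
    simpa using h
  rw [RpolPoly, Polynomial.finsetSum_coeff, Finset.sum_range_succ, Finset.sum_eq_zero, zero_add,
    Polynomial.coeff_C_mul, htop, RpolCoeff, poch_neg_natCast, Nat.choose_self, one_mul]
  · have hs : ((-1 : ℝ) ^ n) * (-1) ^ n = 1 := by rw [← mul_pow]; simp
    have hf : (n.factorial : ℝ) ≠ 0 := by positivity
    field_simp
    rw [sq, hs, one_mul]
  · intro k hk
    rw [Polynomial.coeff_C_mul, Polynomial.coeff_eq_zero_of_natDegree_lt, mul_zero]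
    rw [natDegree_ascPochhammer_comp_neg_X]
    exact Finset.mem_range.1 hk

/-- The squared norm of `(β+1)_n R_n(x; σ, β, γ)` with respect to `hahnWeight σ β γ`. -/
noncomputable def hahnNorm (σ β γ : ℝ) (n : ℕ) : ℝ :=
  poch (1 + β) n * Real.Gamma (1 + γ) * Real.Gamma (γ - β - σ - 2 * n - 1)
      / (Real.Gamma (γ - σ - n) * Real.Gamma (γ - β))
    * (n.factorial * poch (γ - β - n) n * poch (γ - β - 2 * n - σ) n / poch (1 + σ) n)

theorem hasSum_hahnWeight_orthogonality {σ β γ : ℝ} (hσ : -1 < σ) (hβ : -1 < β) {n m : ℕ}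
    (hn : (2 * n : ℝ) < γ - σ - β - 1) (hm : (2 * m : ℝ) < γ - σ - β - 1) :
    HasSum (fun x : ℕ => (poch (β + 1) n * Rpol σ β γ n x) * (poch (β + 1) m * Rpol σ β γ m x)
        * hahnWeight σ β γ x)
      (if n = m then hahnNorm σ β γ n else 0) := by
  have key {n m : ℕ} (hmn : m ≤ n) (hn : (2 * n : ℝ) < γ - σ - β - 1) :
      HasSum (fun x : ℕ => (poch (β + 1) n * Rpol σ β γ n x) * (poch (β + 1) m * Rpol σ β γ m x)
        * hahnWeight σ β γ x)
      (if n = m then hahnNorm σ β γ n else 0) := by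
    have hsum := (hasSum_hahnWeight_mul_Rpol_mul_eval hσ hβ hn hmn (RpolPoly σ β γ m)
      (natDegree_RpolPoly_le σ β γ m)).mul_left (poch (β + 1) n * poch (β + 1) m)
    have hval : poch (β + 1) n * poch (β + 1) m
        * ((RpolPoly σ β γ m).coeff n * RpolTopMoment σ β γ n)
        = if n = m then hahnNorm σ β γ n else 0 := by
      split_ifs with hc
      · subst hc
        have h1 : poch ((n : ℝ) - γ + σ + β + 1) n
            = (-1) ^ n * poch (γ - β - 2 * n - σ) n := by
          rw [show (n : ℝ) - γ + σ + β + 1 = -(γ - σ - β - 1 - n) by ring, poch_neg]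
          congr 2
          ring
        have hs : ((-1 : ℝ) ^ n) * (-1) ^ n = 1 := by rw [← mul_pow]; simp
        have hβn : poch (β + 1) n ≠ 0 := (poch_pos (by linarith) n).ne'
        have hσn : poch (1 + σ) n ≠ 0 := (poch_pos (by linarith) n).ne'
        rw [coeff_RpolPoly, RpolTopMoment, hahnNorm, h1, add_comm 1 β, add_comm 1 γ,
          add_comm σ 1, show γ - β - σ - 2 * n - 1 = γ - σ - β - 1 - 2 * n by ring]
        field_simp
        rw [sq, hs]
        ring
      · rw [Polynomial.coeff_eq_zero_of_natDegree_lt]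
        · ring
        · exact (natDegree_RpolPoly_le σ β γ m).trans_lt (by omega)
    rw [hval] at hsum
    refine hsum.congr_fun fun x => ?_
    rw [eval_RpolPoly]
    ring
  rcases le_total m n with hmn | hmn
  · exact key hmn hn
  · have h := key hmn hm
    by_cases hc : n = m
    · subst hc
      exact h
    · rw [if_neg (Ne.symm hc)] at h
      rw [if_neg hc]
      exact h.congr_fun fun x => by ring

theorem tailFrom_succ (d : ℕ) (y : Fin (d + 1) → ℝ) (t : ℕ) :
    tailFrom (d + 1) y t = tailFrom d (Fin.init y) t + if t ≤ d then y (Fin.last d) else 0 := by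
  simp [tailFrom, Fin.sum_univ_castSucc, Fin.init]

theorem tailFrom_eq_zero {d : ℕ} (y : Fin d → ℝ) {t : ℕ} (ht : d ≤ t) : tailFrom d y t = 0 :=
  Finset.sum_eq_zero fun i _ => if_neg (by omega)

theorem headTo_castSucc (d : ℕ) (y : Fin (d + 1) → ℝ) (j : Fin d) :
    headTo (d + 1) y j.castSucc = headTo d (Fin.init y) j := by
  have : ¬ d < (j : ℕ) := by omega
  simp [headTo, Fin.sum_univ_castSucc, Fin.init, this]

theorem headTo_last (d : ℕ) (y : Fin (d + 1) → ℝ) :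
    headTo (d + 1) y (Fin.last d) = ∑ i, Fin.init y i := by
  simp [headTo, Fin.sum_univ_castSucc, Fin.init]

theorem init_natCast {d : ℕ} (y : Fin (d + 1) → ℕ) :
    Fin.init (fun i => (y i : ℝ)) = fun i => (Fin.init y i : ℝ) := rfl

theorem Rnu_succ (d : ℕ) (σ : Fin (d + 1) → ℝ) (β γ : ℝ) (ν x : Fin (d + 1) → ℕ) :
    Rnu (d + 1) σ β γ ν x
      = Rnu d (Fin.init σ) (β + ν (Fin.last d)) (γ - σ (Fin.last d) - ν (Fin.last d) - 1)
          (Fin.init ν) (Fin.init x)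
        * (poch (β + (∑ i, Fin.init x i : ℕ) + 1) (ν (Fin.last d))
          * Rpol (σ (Fin.last d)) (β + (∑ i, Fin.init x i : ℕ)) (γ + (∑ i, Fin.init x i : ℕ))
              (ν (Fin.last d)) (x (Fin.last d))) := by
  have ha (j : Fin d) : aPar (d + 1) β ν x j.castSucc
      = aPar d (β + ν (Fin.last d)) (Fin.init ν) (Fin.init x) j := by
    rw [aPar, aPar, tailFrom_succ, headTo_castSucc, Fin.val_castSucc, if_pos (by omega),
      init_natCast, init_natCast]
    ring
  have hb (j : Fin d) : bPar (d + 1) γ σ ν x j.castSucc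
      = bPar d (γ - σ (Fin.last d) - ν (Fin.last d) - 1) (Fin.init σ) (Fin.init ν) (Fin.init x) j := by
    rw [bPar, bPar, tailFrom_succ, tailFrom_succ, headTo_castSucc, Fin.val_castSucc,
      if_pos (by omega), if_pos (by omega), init_natCast, init_natCast]
    push_cast
    ring
  have ha' : aPar (d + 1) β ν x (Fin.last d) = β + (∑ i, Fin.init x i : ℕ) := by
    rw [aPar, tailFrom_eq_zero _ (by simp), headTo_last, init_natCast]
    simp
  have hb' : bPar (d + 1) γ σ ν x (Fin.last d) = γ + (∑ i, Fin.init x i : ℕ) := by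
    rw [bPar, tailFrom_eq_zero _ (by simp), tailFrom_eq_zero _ (by simp), headTo_last,
      init_natCast]
    simp
  simp only [Rnu, Fin.prod_univ_castSucc, ha, hb, ha', hb']
  rfl

theorem Wnu_succ (d : ℕ) (σ : Fin (d + 1) → ℝ) (β γ : ℝ) (x : Fin (d + 1) → ℕ) :
    Wnu (d + 1) σ β γ x
      = Wnu d (Fin.init σ) β γ (Fin.init x)
        * hahnWeight (σ (Fin.last d)) (β + (∑ i, Fin.init x i : ℕ))
            (γ + (∑ i, Fin.init x i : ℕ)) (x (Fin.last d)) := by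
  simp only [Wnu, hahnWeight, Fin.prod_univ_castSucc, Fin.sum_univ_castSucc, poch_add, Fin.init,
    add_right_comm _ _ (1 : ℝ)]
  simp only [div_eq_mul_inv, mul_inv]
  ring

theorem Wnu_nonneg {d : ℕ} {σ : Fin d → ℝ} {β γ : ℝ} (hσ : ∀ i, -1 < σ i) (hβ : -1 < β)
    (hγ : -1 < γ) (x : Fin d → ℕ) : 0 ≤ Wnu d σ β γ x := by
  have h1 := (poch_pos (neg_lt_iff_pos_add.1 hβ) (∑ i, x i)).le
  have h2 := (poch_pos (neg_lt_iff_pos_add.1 hγ) (∑ i, x i)).le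
  have h3 (i : Fin d) := (poch_pos (neg_lt_iff_pos_add.1 (hσ i)) (x i)).le
  exact div_nonneg (mul_nonneg (Finset.prod_nonneg fun i _ => div_nonneg (h3 i) (by positivity)) h1)
    h2

theorem Anu_zero {σ : Fin 0 → ℝ} {β γ : ℝ} (hβ : -1 < β) (h : 0 < γ - β - 1)
    (ν : Fin 0 → ℕ) : Anu 0 σ β γ ν = 1 := by
  have h1 := (Real.Gamma_pos_of_pos (show 0 < 1 + γ by linarith)).ne'
  have h2 := (Real.Gamma_pos_of_pos (show 0 < γ - β by linarith)).ne'
  simp [Anu, poch_zero, add_comm γ 1, h1, h2]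

theorem Anu_succ (d : ℕ) (σ : Fin (d + 1) → ℝ) (β γ : ℝ) (ν : Fin (d + 1) → ℕ)
    (hβ : -1 < β) (h : (2 * ν (Fin.last d) : ℝ) < γ - σ (Fin.last d) - β - 1) :
    Anu (d + 1) σ β γ ν
      = hahnNorm (σ (Fin.last d)) β γ (ν (Fin.last d))
        * Anu d (Fin.init σ) (β + ν (Fin.last d)) (γ - σ (Fin.last d) - ν (Fin.last d) - 1)
            (Fin.init ν) := by
  have hdel (t : ℕ) (ht : t ≤ d) : delPar (d + 1) β γ σ ν t
      = delPar d (β + ν (Fin.last d)) (γ - σ (Fin.last d) - ν (Fin.last d) - 1) (Fin.init σ)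
          (Fin.init ν) t := by
    rw [delPar, delPar, tailFrom_succ, tailFrom_succ, if_pos ht, if_pos ht, init_natCast]
    push_cast
    ring
  have hdel1 : delPar (d + 1) β γ σ ν (d + 1) = γ - β := by
    rw [delPar, tailFrom_eq_zero _ le_rfl, tailFrom_eq_zero _ le_rfl]
    simp
  have hdel0 : delPar (d + 1) β γ σ ν d + 1
      = γ - β - 2 * ν (Fin.last d) - σ (Fin.last d) := by
    rw [delPar, tailFrom_succ, tailFrom_succ, tailFrom_eq_zero _ le_rfl,
      tailFrom_eq_zero _ le_rfl]
    simp
  have hn : (0 : ℝ) ≤ ν (Fin.last d) := Nat.cast_nonneg _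
  have h1 := (Real.Gamma_pos_of_pos
    (show 0 < γ - σ (Fin.last d) - ν (Fin.last d) by linarith)).ne'
  have h2 := (Real.Gamma_pos_of_pos
    (show 0 < γ - β - σ (Fin.last d) - 2 * ν (Fin.last d) - 1 by linarith)).ne'
  have hprod : (∏ j : Fin d, (Nat.factorial (ν j.castSucc) : ℝ)
        * poch (delPar (d + 1) β γ σ ν ((j : ℕ) + 1) - ν j.castSucc) (ν j.castSucc)
        * poch (delPar (d + 1) β γ σ ν (j : ℕ) + 1) (ν j.castSucc)
          / poch (1 + σ j.castSucc) (ν j.castSucc))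
      = ∏ j : Fin d, (Nat.factorial (Fin.init ν j) : ℝ)
        * poch (delPar d (β + ν (Fin.last d)) (γ - σ (Fin.last d) - ν (Fin.last d) - 1)
            (Fin.init σ) (Fin.init ν) ((j : ℕ) + 1) - Fin.init ν j) (Fin.init ν j)
        * poch (delPar d (β + ν (Fin.last d)) (γ - σ (Fin.last d) - ν (Fin.last d) - 1)
            (Fin.init σ) (Fin.init ν) (j : ℕ) + 1) (Fin.init ν j)
          / poch (1 + Fin.init σ j) (Fin.init ν j) :=
    Finset.prod_congr rfl fun j _ => by rw [hdel _ (by omega), hdel _ (by omega)]; rfl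
  have hs (f : Fin (d + 1) → ℝ) : ∑ i, f i = ∑ i, Fin.init f i + f (Fin.last d) :=
    Fin.sum_univ_castSucc f
  have hsν : ∑ i, ν i = ν (Fin.last d) + ∑ i, Fin.init ν i := by
    rw [Fin.sum_univ_castSucc, add_comm]; rfl
  have halg (p q g a b c : ℝ) {G H P K : ℝ} (hG : G ≠ 0) (hH : H ≠ 0) :
      p * q * g * a / (b * c) * (P * K) = p * g * H / (G * c) * K * (q * G * a / (b * H) * P) := by
    field_simp
  rw [Anu, Anu, hahnNorm, Fin.prod_univ_castSucc]
  simp only [Fin.val_castSucc, Fin.val_last]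
  rw [hprod, hdel1, hdel0, hsν, poch_add, hs σ, hs fun i => (ν i : ℝ), init_natCast]
  generalize (∏ j : Fin d, (Nat.factorial (Fin.init ν j) : ℝ) * _ * _ / _) = P
  rw [show γ - β - (∑ i, Fin.init σ i + σ (Fin.last d))
        - 2 * (∑ i, (Fin.init ν i : ℝ) + ν (Fin.last d)) - ((d + 1 : ℕ) : ℝ)
      = γ - σ (Fin.last d) - ν (Fin.last d) - 1 - (β + ν (Fin.last d)) - ∑ i, Fin.init σ i
        - 2 * ∑ i, (Fin.init ν i : ℝ) - d by push_cast; ring,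
    show γ - (∑ i, Fin.init σ i + σ (Fin.last d)) - (∑ i, (Fin.init ν i : ℝ) + ν (Fin.last d)) + 1
        - ((d + 1 : ℕ) : ℝ)
      = γ - σ (Fin.last d) - ν (Fin.last d) - 1 - ∑ i, Fin.init σ i
        - ∑ i, (Fin.init ν i : ℝ) + 1 - d by push_cast; ring,
    show 1 + (γ - σ (Fin.last d) - ν (Fin.last d) - 1) = γ - σ (Fin.last d) - ν (Fin.last d) by ring,
    show γ - σ (Fin.last d) - ν (Fin.last d) - 1 - (β + ν (Fin.last d))
      = γ - β - σ (Fin.last d) - 2 * ν (Fin.last d) - 1 by ring, ← add_assoc 1 β]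
  exact halg _ _ _ _ _ _ h1 h2

theorem hahnNorm_add {σ β γ : ℝ} (hβ : -1 < β) {n : ℕ} (h : (2 * n : ℝ) < γ - σ - β - 1)
    (hγ : -1 < γ) (X : ℕ) :
    hahnNorm σ (β + X) (γ + X) n * (poch (β + 1) X / poch (γ + 1) X)
      = hahnNorm σ β γ n * (poch (β + n + 1) X / poch (γ - σ - n - 1 + 1) X) := by
  have hn : (0 : ℝ) ≤ n := Nat.cast_nonneg _
  have hβn : poch (1 + (β + X)) n * poch (β + 1) X = poch (1 + β) n * poch (β + n + 1) X := by
    rw [mul_comm, add_comm β 1, ← add_assoc, ← poch_add, add_comm X n, poch_add]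
    ring_nf
  have hγ' : 0 < γ + 1 := by linarith
  have hG : 0 < γ - σ - n := by linarith
  have h1 := (poch_pos hγ' X).ne'
  have h2 := (poch_pos hG X).ne'
  have h3 := (Real.Gamma_pos_of_pos hG).ne'
  rw [hahnNorm, hahnNorm, show 1 + (γ + X) = γ + 1 + (X : ℝ) by ring, Gamma_add_nat_eq hγ',
    show γ + X - σ - n = γ - σ - n + (X : ℝ) by ring, Gamma_add_nat_eq hG, add_sub_add_right_eq_sub,
    sub_add_cancel, add_comm 1 γ]
  field_simp
  linear_combination (Real.Gamma (γ - β - σ - 2 * n - 1) * poch (γ - β - n) n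
    * poch (γ - β - 2 * n - σ) n / (Real.Gamma (γ - β) * poch (1 + σ) n)) * hβn

theorem hahnNorm_mul_Wnu {d : ℕ} (σ : Fin d → ℝ) {s β γ : ℝ} (hβ : -1 < β) {n : ℕ}
    (h : (2 * n : ℝ) < γ - s - β - 1) (hγ : -1 < γ) (x : Fin d → ℕ) :
    hahnNorm s (β + (∑ i, x i : ℕ)) (γ + (∑ i, x i : ℕ)) n * Wnu d σ β γ x
      = hahnNorm s β γ n * Wnu d σ (β + n) (γ - s - n - 1) x := by
  have := hahnNorm_add hβ h hγ (∑ i, x i)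
  rw [Wnu, Wnu, mul_div_assoc, mul_div_assoc, mul_left_comm, this, mul_left_comm]

theorem hasSum_snoc {d : ℕ} {f : (Fin (d + 1) → ℕ) → ℝ} {a : ℝ} :
    HasSum f a ↔ HasSum (fun p : (Fin d → ℕ) × ℕ => f (Fin.snoc p.1 p.2)) a :=
  (((Equiv.prodComm _ _).trans (Fin.snocEquiv fun _ : Fin (d + 1) => ℕ)).hasSum_iff
    (f := f) (a := a)).symm

theorem summable_snoc {d : ℕ} {f : (Fin (d + 1) → ℕ) → ℝ} :
    Summable f ↔ Summable (fun p : (Fin d → ℕ) × ℕ => f (Fin.snoc p.1 p.2)) :=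
  (((Equiv.prodComm _ _).trans (Fin.snocEquiv fun _ : Fin (d + 1) => ℕ)).summable_iff
    (f := f)).symm

theorem two_mul_last_lt {d : ℕ} {σ : Fin (d + 1) → ℝ} {β γ : ℝ} (hσ : ∀ i, -1 < σ i)
    {ν : Fin (d + 1) → ℕ}
    (hν : 2 * ((∑ i, ν i : ℕ) : ℝ) < γ - (∑ i, σ i) - β - (d + 1 : ℕ) - 1) :
    (2 * ν (Fin.last d) : ℝ) < γ - σ (Fin.last d) - β - 1 := by
  have h1 : ∑ i : Fin d, (-1 : ℝ) ≤ ∑ i : Fin d, σ i.castSucc :=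
    Finset.sum_le_sum fun i _ => (hσ _).le
  have h2 : (0 : ℝ) ≤ (∑ i : Fin d, ν i.castSucc : ℕ) := Nat.cast_nonneg _
  rw [Fin.sum_univ_castSucc, Fin.sum_univ_castSucc] at hν
  simp at h1
  push_cast at *
  linarith

theorem two_mul_sum_init_lt {d : ℕ} {σ : Fin (d + 1) → ℝ} {β γ : ℝ} {ν : Fin (d + 1) → ℕ}
    (hν : 2 * ((∑ i, ν i : ℕ) : ℝ) < γ - (∑ i, σ i) - β - (d + 1 : ℕ) - 1) :
    2 * ((∑ i, Fin.init ν i : ℕ) : ℝ)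
      < (γ - σ (Fin.last d) - ν (Fin.last d) - 1) - (∑ i, Fin.init σ i)
        - (β + ν (Fin.last d)) - d - 1 := by
  rw [Fin.sum_univ_castSucc, Fin.sum_univ_castSucc] at hν
  simp only [Fin.init]
  push_cast at *
  linarith

theorem neg_one_lt_of_two_mul_sum_lt {d : ℕ} {σ : Fin d → ℝ} {β γ : ℝ} (hσ : ∀ i, -1 < σ i)
    (hβ : -1 < β) {ν : Fin d → ℕ}
    (hν : 2 * ((∑ i, ν i : ℕ) : ℝ) < γ - (∑ i, σ i) - β - d - 1) : -1 < γ := by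
  have h1 : ∑ i : Fin d, (-1 : ℝ) ≤ ∑ i, σ i := Finset.sum_le_sum fun i _ => (hσ _).le
  have h2 : (0 : ℝ) ≤ (∑ i, ν i : ℕ) := Nat.cast_nonneg _
  simp at h1
  linarith

/-- Summing over the last coordinate. -/
theorem hasSum_Rnu_mul_Rnu_mul_Wnu_snoc {d : ℕ} {σ : Fin (d + 1) → ℝ} {β γ : ℝ}
    (hσ : ∀ i, -1 < σ i) (hβ : -1 < β) (hγ : -1 < γ) {ν μ : Fin (d + 1) → ℕ}
    (hν : (2 * ν (Fin.last d) : ℝ) < γ - σ (Fin.last d) - β - 1)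
    (hμ : (2 * μ (Fin.last d) : ℝ) < γ - σ (Fin.last d) - β - 1) (x : Fin d → ℕ) :
    HasSum (fun t : ℕ => Rnu (d + 1) σ β γ ν (Fin.snoc x t) * Rnu (d + 1) σ β γ μ (Fin.snoc x t)
        * Wnu (d + 1) σ β γ (Fin.snoc x t))
      (if ν (Fin.last d) = μ (Fin.last d) then
        hahnNorm (σ (Fin.last d)) β γ (ν (Fin.last d))
          * (Rnu d (Fin.init σ) (β + ν (Fin.last d)) (γ - σ (Fin.last d) - ν (Fin.last d) - 1)
              (Fin.init ν) x
            * Rnu d (Fin.init σ) (β + ν (Fin.last d)) (γ - σ (Fin.last d) - ν (Fin.last d) - 1)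
              (Fin.init μ) x
            * Wnu d (Fin.init σ) (β + ν (Fin.last d)) (γ - σ (Fin.last d) - ν (Fin.last d) - 1) x)
      else 0) := by
  have hX : (0 : ℝ) ≤ (∑ i, x i : ℕ) := Nat.cast_nonneg _
  have h := (hasSum_hahnWeight_orthogonality (hσ (Fin.last d))
    (show -1 < β + ((∑ i, x i : ℕ) : ℝ) by linarith) (n := ν (Fin.last d)) (m := μ (Fin.last d))
    (γ := γ + (∑ i, x i : ℕ)) (by linarith) (by linarith)).mul_left
    (Rnu d (Fin.init σ) (β + ν (Fin.last d)) (γ - σ (Fin.last d) - ν (Fin.last d) - 1)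
        (Fin.init ν) x
      * Rnu d (Fin.init σ) (β + μ (Fin.last d)) (γ - σ (Fin.last d) - μ (Fin.last d) - 1)
        (Fin.init μ) x * Wnu d (Fin.init σ) β γ x)
  have hval : Rnu d (Fin.init σ) (β + ν (Fin.last d)) (γ - σ (Fin.last d) - ν (Fin.last d) - 1)
        (Fin.init ν) x
      * Rnu d (Fin.init σ) (β + μ (Fin.last d)) (γ - σ (Fin.last d) - μ (Fin.last d) - 1)
        (Fin.init μ) x * Wnu d (Fin.init σ) β γ x
      * (if ν (Fin.last d) = μ (Fin.last d) then
          hahnNorm (σ (Fin.last d)) (β + (∑ i, x i : ℕ)) (γ + (∑ i, x i : ℕ)) (ν (Fin.last d))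
        else 0)
      = (if ν (Fin.last d) = μ (Fin.last d) then
        hahnNorm (σ (Fin.last d)) β γ (ν (Fin.last d))
          * (Rnu d (Fin.init σ) (β + ν (Fin.last d)) (γ - σ (Fin.last d) - ν (Fin.last d) - 1)
              (Fin.init ν) x
            * Rnu d (Fin.init σ) (β + ν (Fin.last d)) (γ - σ (Fin.last d) - ν (Fin.last d) - 1)
              (Fin.init μ) x
            * Wnu d (Fin.init σ) (β + ν (Fin.last d)) (γ - σ (Fin.last d) - ν (Fin.last d) - 1) x)
        else 0) := by
    split_ifs with hc
    · rw [← hc]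
      linear_combination
        (Rnu d (Fin.init σ) (β + ν (Fin.last d)) (γ - σ (Fin.last d) - ν (Fin.last d) - 1)
          (Fin.init ν) x
        * Rnu d (Fin.init σ) (β + ν (Fin.last d)) (γ - σ (Fin.last d) - ν (Fin.last d) - 1)
          (Fin.init μ) x) * hahnNorm_mul_Wnu (Fin.init σ) hβ hν hγ x
    · ring
  rw [hval] at h
  refine h.congr_fun fun t => ?_
  simp only [Rnu_succ, Wnu_succ, Fin.init_snoc, Fin.snoc_last]
  ring

theorem summable_Rnu_mul_Rnu_mul_Wnu_of_self {d : ℕ} {σ : Fin d → ℝ} {β γ : ℝ}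
    (hσ : ∀ i, -1 < σ i) (hβ : -1 < β) (hγ : -1 < γ) {ν μ : Fin d → ℕ}
    (hν : Summable fun x => Rnu d σ β γ ν x * Rnu d σ β γ ν x * Wnu d σ β γ x)
    (hμ : Summable fun x => Rnu d σ β γ μ x * Rnu d σ β γ μ x * Wnu d σ β γ x) :
    Summable fun x => Rnu d σ β γ ν x * Rnu d σ β γ μ x * Wnu d σ β γ x := by
  refine Summable.of_norm_bounded (hν.add hμ) fun x => ?_
  rw [← add_mul, Real.norm_eq_abs, abs_mul, abs_of_nonneg (Wnu_nonneg hσ hβ hγ x)]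
  refine mul_le_mul_of_nonneg_right ?_ (Wnu_nonneg hσ hβ hγ x)
  rw [abs_le]
  constructor <;> nlinarith [sq_nonneg (Rnu d σ β γ ν x + Rnu d σ β γ μ x),
    sq_nonneg (Rnu d σ β γ ν x - Rnu d σ β γ μ x), sq_nonneg (Rnu d σ β γ ν x),
    sq_nonneg (Rnu d σ β γ μ x)]

theorem summable_Rnu_mul_self_mul_Wnu {d : ℕ} {σ : Fin d → ℝ} {β γ : ℝ} (hσ : ∀ i, -1 < σ i)
    (hβ : -1 < β) {ν : Fin d → ℕ}
    (hν : 2 * ((∑ i, ν i : ℕ) : ℝ) < γ - (∑ i, σ i) - β - d - 1) :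
    Summable fun x => Rnu d σ β γ ν x * Rnu d σ β γ ν x * Wnu d σ β γ x := by
  induction d generalizing β γ with
  | zero => exact (hasSum_fintype _).summable
  | succ d ih =>
    have hγ := neg_one_lt_of_two_mul_sum_lt hσ hβ hν
    have hinner := hasSum_Rnu_mul_Rnu_mul_Wnu_snoc hσ hβ hγ (two_mul_last_lt hσ hν)
      (two_mul_last_lt hσ hν)
    rw [summable_snoc, summable_prod_of_nonneg fun p =>
      mul_nonneg (mul_self_nonneg _) (Wnu_nonneg hσ hβ hγ _)]
    refine ⟨fun x => (hinner x).summable, ?_⟩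
    simp only [(hinner _).tsum_eq, if_true]
    have hn : (0 : ℝ) ≤ ν (Fin.last d) := Nat.cast_nonneg _
    exact (ih (fun i => hσ i.castSucc) (by linarith) (two_mul_sum_init_lt hν)).mul_left _

theorem summable_Rnu_mul_Rnu_mul_Wnu {d : ℕ} {σ : Fin d → ℝ} {β γ : ℝ} (hσ : ∀ i, -1 < σ i)
    (hβ : -1 < β) {ν μ : Fin d → ℕ}
    (hν : 2 * ((∑ i, ν i : ℕ) : ℝ) < γ - (∑ i, σ i) - β - d - 1)
    (hμ : 2 * ((∑ i, μ i : ℕ) : ℝ) < γ - (∑ i, σ i) - β - d - 1) :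
    Summable fun x => Rnu d σ β γ ν x * Rnu d σ β γ μ x * Wnu d σ β γ x :=
  summable_Rnu_mul_Rnu_mul_Wnu_of_self hσ hβ (neg_one_lt_of_two_mul_sum_lt hσ hβ hν)
    (summable_Rnu_mul_self_mul_Wnu hσ hβ hν) (summable_Rnu_mul_self_mul_Wnu hσ hβ hμ)

theorem hasSum_Rnu_mul_Rnu_mul_Wnu {d : ℕ} {σ : Fin d → ℝ} {β γ : ℝ} (hσ : ∀ i, -1 < σ i)
    (hβ : -1 < β) {ν μ : Fin d → ℕ}
    (hν : 2 * ((∑ i, ν i : ℕ) : ℝ) < γ - (∑ i, σ i) - β - d - 1)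
    (hμ : 2 * ((∑ i, μ i : ℕ) : ℝ) < γ - (∑ i, σ i) - β - d - 1) :
    HasSum (fun x => Rnu d σ β γ ν x * Rnu d σ β γ μ x * Wnu d σ β γ x)
      (if ν = μ then Anu d σ β γ ν else 0) := by
  induction d generalizing β γ with
  | zero =>
    have h0 : 0 < γ - β - 1 := by simpa using hν
    rw [if_pos (Subsingleton.elim _ _), Anu_zero hβ h0]
    simp [Rnu, Wnu, poch_zero]
  | succ d ih =>
    have hγ := neg_one_lt_of_two_mul_sum_lt hσ hβ hν
    have hinner := hasSum_Rnu_mul_Rnu_mul_Wnu_snoc hσ hβ hγ (two_mul_last_lt hσ hν)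
      (two_mul_last_lt hσ hμ)
    have hsum := (summable_snoc.1 (summable_Rnu_mul_Rnu_mul_Wnu hσ hβ hν hμ)).hasSum
    have houter := hsum.prod_fiberwise hinner
    have hn : (0 : ℝ) ≤ ν (Fin.last d) := Nat.cast_nonneg _
    have hext : ν = μ ↔ ν (Fin.last d) = μ (Fin.last d) ∧ Fin.init ν = Fin.init μ := by
      constructor
      · rintro rfl
        exact ⟨rfl, rfl⟩
      · rintro ⟨h1, h2⟩
        rw [← Fin.snoc_init_self ν, ← Fin.snoc_init_self μ, h1, h2]
    have hval : HasSum (fun x : Fin d → ℕ => if ν (Fin.last d) = μ (Fin.last d) then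
        hahnNorm (σ (Fin.last d)) β γ (ν (Fin.last d))
          * (Rnu d (Fin.init σ) (β + ν (Fin.last d)) (γ - σ (Fin.last d) - ν (Fin.last d) - 1)
              (Fin.init ν) x
            * Rnu d (Fin.init σ) (β + ν (Fin.last d)) (γ - σ (Fin.last d) - ν (Fin.last d) - 1)
              (Fin.init μ) x
            * Wnu d (Fin.init σ) (β + ν (Fin.last d)) (γ - σ (Fin.last d) - ν (Fin.last d) - 1) x)
        else 0) (if ν = μ then Anu (d + 1) σ β γ ν else 0) := by
      by_cases hc : ν (Fin.last d) = μ (Fin.last d)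
      · simp only [hext, hc, if_true, true_and]
        rw [← hc, Anu_succ d σ β γ ν hβ (two_mul_last_lt hσ hν), ← mul_ite_zero]
        have hμ' := two_mul_sum_init_lt hμ
        rw [← hc] at hμ'
        exact (ih (fun i => hσ i.castSucc) (by linarith) (two_mul_sum_init_lt hν) hμ').mul_left _
      · simp only [hext, hc, if_false, false_and]
        exact hasSum_zero
    rw [hasSum_snoc, hval.unique houter]
    exact hsum

/-- Theorem 5.2: mutual orthogonality of the polynomials `R_ν` on `ℕ₀^d` with
respect to the weight `W`, with the explicit norm `A_ν`. -/
theorem Rnu_orthogonality (d : ℕ) (hd : 1 ≤ d) (σ : Fin d → ℝ) (β γ : ℝ)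
    (hσ : ∀ i, -1 < σ i) (hβ : -1 < β)
    (ν μ : Fin d → ℕ)
    (hν : 2 * ((∑ i, ν i : ℕ) : ℝ) < γ - (∑ i, σ i) - β - d - 1)
    (hμ : 2 * ((∑ i, μ i : ℕ) : ℝ) < γ - (∑ i, σ i) - β - d - 1) :
    Summable (fun x : Fin d → ℕ => Rnu d σ β γ ν x * Rnu d σ β γ μ x * Wnu d σ β γ x)
    ∧ ∑' x : Fin d → ℕ, Rnu d σ β γ ν x * Rnu d σ β γ μ x * Wnu d σ β γ x
      = if ν = μ then Anu d σ β γ ν else 0 := by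
  have h := hasSum_Rnu_mul_Rnu_mul_Wnu hσ hβ hν hμ
  exact ⟨h.summable, h.tsum_eq⟩
end

section
/- Let d ≥ 2 and let l_{i,j}, s_i ∈ ℝ (1 ≤ i,j ≤ d) with l_{i,j} ≠ 0 for all i ≠ j and Σ_{k=1}^d l_{k,i} ≠ 0 for all i. Define α_{i,j}(x) = −l_{i,j} x_j for i ≠ j, β_i(x) = Σ_{k≠i} l_{i,k} x_k + (l_{i,i} − 1) x_i + s_i, and γ_i(x) = x_i Σ_{k=1}^d l_{k,i}. Then the compatibility conditions — α_{i,j}(x−e_i) β_j(x−e_j) γ_i(x) = α_{j,i}(x−e_j) β_i(x−e_i) γ_j(x) and β_i(x−e_i) β_j(x−e_i−e_j) γ_j(x) γ_i(x−e_j) = β_j(x−e_j) β_i(x−e_i−e_j) γ_i(x) γ_j(x−e_i) — hold for all x ∈ ℝ^d and all 1 ≤ i ≠ j ≤ d if and only if there exist real numbers s and l_1, …, l_d such that for all i: l_{i,j} = l_i for every j ≠ i, l_{i,i} = l_i + 1, and s_i = l_i s. -/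
open Finset

/-- The `i`-th standard basis vector of `ℝ^d`. -/
def er (d : ℕ) (i : Fin d) : Fin d → ℝ := fun j => if j = i then 1 else 0

theorem er_self (d : ℕ) (i : Fin d) : er d i i = 1 := by simp [er]

theorem er_of_ne {d : ℕ} {i j : Fin d} (h : j ≠ i) : er d i j = 0 := by simp [er, h]

theorem sum_er (d : ℕ) (i : Fin d) : ∑ k, er d i k = 1 := by simp [er]

theorem sum_ite_ne_eq {d : ℕ} (i : Fin d) (f : Fin d → ℝ) :
    (∑ k, if k ≠ i then f k else 0) = (∑ k, f k) - f i := by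
  rw [← sum_filter, filter_ne', ← add_sum_erase univ f (mem_univ i)]
  ring

theorem sum_mul_er_add_er {d : ℕ} (f : Fin d → ℝ) (i j : Fin d) (a b : ℝ) :
    ∑ k, f k * (a • er d i + b • er d j) k = f i * a + f j * b := by
  simp [er, mul_add, sum_add_distrib]

/-- Proposition 6.1: in the linear-eigenvalue case (`a = 0`, `b = −1`) with all
off-diagonal `l_{i,j} ≠ 0`, the compatibility conditions hold iff the
coefficients have the form (6.6). -/
theorem compat_solutions_linear (d : ℕ) (hd : 2 ≤ d)
    (l : Fin d → Fin d → ℝ) (s : Fin d → ℝ)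
    (hloff : ∀ i j : Fin d, i ≠ j → l i j ≠ 0)
    (hlsum : ∀ i : Fin d, (∑ k, l k i) ≠ 0)
    (α : Fin d → Fin d → (Fin d → ℝ) → ℝ)
    (hα : ∀ i j, i ≠ j → ∀ x : Fin d → ℝ, α i j x = -(l i j) * x j)
    (β : Fin d → (Fin d → ℝ) → ℝ)
    (hβ : ∀ i, ∀ x : Fin d → ℝ,
        β i x = (∑ k, if k ≠ i then l i k * x k else 0) + (l i i - 1) * x i + s i)
    (γ : Fin d → (Fin d → ℝ) → ℝ)
    (hγ : ∀ i, ∀ x : Fin d → ℝ, γ i x = x i * ∑ k, l k i) :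
    ((∀ i j : Fin d, i ≠ j → ∀ x : Fin d → ℝ,
        α i j (x - er d i) * β j (x - er d j) * γ i x
          = α j i (x - er d j) * β i (x - er d i) * γ j x)
      ∧ (∀ i j : Fin d, i ≠ j → ∀ x : Fin d → ℝ,
        β i (x - er d i) * β j (x - er d i - er d j) * γ j x * γ i (x - er d j)
          = β j (x - er d j) * β i (x - er d i - er d j) * γ i x * γ j (x - er d i)))
    ↔ (∃ t : ℝ, ∃ L : Fin d → ℝ, ∀ i : Fin d,
        (∀ j : Fin d, j ≠ i → l i j = L i) ∧ l i i = L i + 1 ∧ s i = L i * t) := by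
  have hβ' : ∀ i x, β i x = (∑ k, l i k * x k) - x i + s i := by
    intro i x
    rw [hβ, sum_ite_ne_eq]
    ring
  constructor
  · rintro ⟨-, h⟩
    have key : ∀ i j, i ≠ j → ∀ a b : ℝ, a ≠ 0 → b ≠ 0 →
        l j i * ((l i i - 1) * (a - 1) + l i j * b + s i)
          = l i j * (l j i * a + (l j j - 1) * (b - 1) + s j) := by
      intro i j hij a b ha hb
      have hi : ∀ a b : ℝ, β i (a • er d i + b • er d j) = (l i i - 1) * a + l i j * b + s i := by
        intro a b
        rw [hβ', sum_mul_er_add_er]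
        simp [er_self, er_of_ne hij]
        ring
      have hj : ∀ a b : ℝ, β j (a • er d i + b • er d j) = l j i * a + (l j j - 1) * b + s j := by
        intro a b
        rw [hβ', sum_mul_er_add_er]
        simp [er_self, er_of_ne hij.symm]
        ring
      have h1 : a • er d i + b • er d j - er d i = (a - 1) • er d i + b • er d j := by module
      have h2 : a • er d i + b • er d j - er d j = a • er d i + (b - 1) • er d j := by module
      have h3 : (a - 1) • er d i + b • er d j - er d j
          = (a - 1) • er d i + (b - 1) • er d j := by module
      have hx := h i j hij (a • er d i + b • er d j)
      rw [h1, h2, h3, hi, hi, hj, hj, hγ, hγ, hγ, hγ] at hx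
      simp only [Pi.add_apply, Pi.smul_apply, er_self, er_of_ne hij, er_of_ne hij.symm,
        smul_eq_mul] at hx
      have hne : a * b * (∑ k, l k i) * (∑ k, l k j) ≠ 0 :=
        mul_ne_zero (mul_ne_zero (mul_ne_zero ha hb) (hlsum i)) (hlsum j)
      apply mul_left_cancel₀ hne
      linear_combination -hx
    have diag : ∀ i j, j ≠ i → l i j = l i i - 1 := by
      intro i j hji
      have h11 := key j i hji 1 1 one_ne_zero one_ne_zero
      have h12 := key j i hji 1 2 one_ne_zero two_ne_zero
      apply mul_left_cancel₀ (hloff j i hji)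
      linear_combination h12 - h11
    have cross : ∀ i j, i ≠ j → (l j j - 1) * s i = (l i i - 1) * s j := by
      intro i j hij
      have h11 := key i j hij 1 1 one_ne_zero one_ne_zero
      rw [diag i j hij.symm, diag j i hij] at h11
      linear_combination h11
    have : Nontrivial (Fin d) := Fin.nontrivial_iff_two_le.mpr hd
    obtain ⟨i₀, j₀, h₀⟩ := exists_pair_ne (Fin d)
    have hne : l i₀ i₀ - 1 ≠ 0 := diag i₀ j₀ h₀.symm ▸ hloff i₀ j₀ h₀
    refine ⟨s i₀ / (l i₀ i₀ - 1), fun i => l i i - 1, fun i => ⟨diag i, by ring, ?_⟩⟩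
    rcases eq_or_ne i i₀ with rfl | hi
    · field_simp
    · field_simp
      linear_combination cross i i₀ hi
  · rintro ⟨t, L, hL⟩
    have hl : ∀ i k, l i k = L i + er d i k := by
      intro i k
      rcases eq_or_ne k i with rfl | hk
      · rw [(hL k).2.1, er_self]
      · rw [(hL i).1 k hk, er_of_ne hk, add_zero]
    have hB : ∀ i x, β i x = L i * (∑ k, x k + t) := by
      intro i x
      rw [hβ', (hL i).2.2]
      simp only [hl, add_mul, sum_add_distrib, ← mul_sum]
      simp [er]
      ring
    have hS : ∀ i, ∑ k, l k i = ∑ k, L k + 1 := by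
      intro i
      simp [hl, sum_add_distrib, er]
    constructor <;> intro i j hij x
    · rw [hα i j hij, hα j i hij.symm, (hL i).1 j hij.symm, (hL j).1 i hij]
      simp only [hB, hγ, hS, Pi.sub_apply, sum_sub_distrib, sum_er, er_of_ne hij,
        er_of_ne hij.symm]
      ring
    · simp only [hB, hγ, hS, Pi.sub_apply, sum_sub_distrib, sum_er, er_of_ne hij,
        er_of_ne hij.symm]
      ring
end

section
/- Let d ≥ 2 and let l_{i,j} ∈ ℝ (1 ≤ i,j ≤ d) satisfy l_{j,i} l_{i,k} = l_{i,j} l_{j,k} for all pairwise distinct i, j, k, and l_{i,j} = 0 ⟺ l_{j,i} = 0 for all i ≠ j. Suppose l_{i,j} = 0 for some fixed i ≠ j. Define I = {i} ∪ {m : m ≠ i and l_{m,i} ≠ 0} and J = {1,…,d} \ I (so j ∈ J). Then l_{m,k} = l_{k,m} = 0 for every m ∈ I and every k ∈ J. Consequently, the difference operator D with coefficients α_{p,q}(x) = −l_{p,q} x_q (p ≠ q), β_p(x) = Σ_{k≠p} l_{p,k} x_k + (l_{p,p} − 1) x_p + s_p, γ_p(x) = x_p Σ_{k=1}^d l_{k,p}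 decomposes as D = D_I + D_J, where D_I is the operator containing exactly the terms α_{p,q}(x) f(x+e_p−e_q) with p, q ∈ I, β_p(x) f(x+e_p) and γ_p(x) f(x−e_p) with p ∈ I (whose coefficients depend only on the variables x_m, m ∈ I), and D_J is defined analogously with J. -/
open Finset
open scoped Classical

/-- The part of the difference operator (with linear eigenvalues, coefficients
`α_{p,q}(x) = −l_{p,q} x_q`, `β_p(x) = Σ_{k≠p} l_{p,k} x_k + (l_{p,p}−1) x_p + s_p`,
`γ_p(x) = x_p Σ_k l_{k,p}`) containing exactly the terms with indices in `T`. -/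
noncomputable def DopOn (d : ℕ) (l : Fin d → Fin d → ℝ) (s : Fin d → ℝ)
    (T : Finset (Fin d)) (f : (Fin d → ℝ) → ℝ) (x : Fin d → ℝ) : ℝ :=
  (∑ p ∈ T, ∑ q ∈ T, if p ≠ q then
      (-(l p q) * x q) * f (x + er d p - er d q) else 0)
    + (∑ p ∈ T, ((∑ k, if k ≠ p then l p k * x k else 0)
        + (l p p - 1) * x p + s p) * f (x + er d p))
    + (∑ p ∈ T, (x p * ∑ k, l k p) * f (x - er d p))

/-- Theorem 6.6: if `l_{i,j} = 0` for some `i ≠ j`, then with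
`I = {i} ∪ {m : l_{m,i} ≠ 0}` and `J = I^c ∋ j` one has
`l_{m,k} = l_{k,m} = 0` for `m ∈ I`, `k ∈ J`, and the operator decomposes as
`D = D_I + D_J`. -/
theorem Dop_decomposes (d : ℕ) (hd : 2 ≤ d)
    (l : Fin d → Fin d → ℝ) (s : Fin d → ℝ)
    (hrel : ∀ i j k : Fin d, i ≠ j → j ≠ k → i ≠ k →
        l j i * l i k = l i j * l j k)
    (hsym : ∀ i j : Fin d, i ≠ j → (l i j = 0 ↔ l j i = 0))
    (i j : Fin d) (hij : i ≠ j) (hzero : l i j = 0)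
    (I : Finset (Fin d))
    (hI : I = insert i (Finset.univ.filter fun m => m ≠ i ∧ l m i ≠ 0))
    (J : Finset (Fin d)) (hJ : J = Iᶜ) :
    j ∈ J
    ∧ (∀ m ∈ I, ∀ k ∈ J, l m k = 0 ∧ l k m = 0)
    ∧ (∀ f : (Fin d → ℝ) → ℝ, ∀ x : Fin d → ℝ,
        DopOn d l s Finset.univ f x = DopOn d l s I f x + DopOn d l s J f x) := by
  have hmem : ∀ m, m ∈ I ↔ m = i ∨ (m ≠ i ∧ l m i ≠ 0) := by
    intro m; simp [hI]
  have hmemJ : ∀ k, k ∈ J ↔ k ≠ i ∧ l k i = 0 := by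
    intro k
    rw [hJ, Finset.mem_compl, hmem]
    tauto
  have hvanish : ∀ m ∈ I, ∀ k ∈ J, l m k = 0 ∧ l k m = 0 := by
    intro m hm k hk
    have hmk : m ≠ k := by
      rintro rfl
      rw [hJ, Finset.mem_compl] at hk
      exact hk hm
    obtain ⟨hki, hk0⟩ := (hmemJ k).1 hk
    have hik : l i k = 0 := (hsym k i hki).1 hk0
    have hmk0 : l m k = 0 := by
      rcases (hmem m).1 hm with rfl | ⟨hmi, hm0⟩
      · exact hik
      · have hr := hrel i m k hmi.symm hmk hki.symm
        rw [hik, mul_zero] at hr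
        exact (mul_eq_zero.1 hr.symm).resolve_left fun h => hm0 ((hsym i m hmi.symm).1 h)
    exact ⟨hmk0, (hsym m k hmk).1 hmk0⟩
  refine ⟨(hmemJ j).2 ⟨hij.symm, (hsym i j hij).1 hzero⟩, hvanish, fun f x => ?_⟩
  have hsplit : ∀ g : Fin d → ℝ, ∑ p, g p = ∑ p ∈ I, g p + ∑ p ∈ J, g p := by
    intro g
    rw [hJ, Finset.sum_add_sum_compl]
  have hpairs : ∀ g : Fin d → Fin d → ℝ,
      (∀ m ∈ I, ∀ k ∈ J, g m k = 0 ∧ g k m = 0) →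
      ∑ p, ∑ q, g p q = ∑ p ∈ I, ∑ q ∈ I, g p q + ∑ p ∈ J, ∑ q ∈ J, g p q := by
    intro g hg
    rw [hsplit]
    congr 1
    · refine Finset.sum_congr rfl fun p hp => ?_
      rw [hsplit, Finset.sum_eq_zero fun q hq => (hg p hp q hq).1, add_zero]
    · refine Finset.sum_congr rfl fun p hp => ?_
      rw [hsplit, Finset.sum_eq_zero fun q hq => (hg q hq p hp).2, zero_add]
  unfold DopOn
  rw [hpairs _ fun m hm k hk => by simp [hvanish m hm k hk],
    hsplit fun p => ((∑ k, if k ≠ p then l p k * x k else 0)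
        + (l p p - 1) * x p + s p) * f (x + er d p),
    hsplit fun p => (x p * ∑ k, l k p) * f (x - er d p)]
  ring
end
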